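/- arXiv:1710.10130 — 2 statements merged into one kernel-verified Lean document; each statement's English description precedes it below -/
import Mathlib

section
/- For each n ∈ ℕ let Xₙ be a random vector uniformly distributed in the cube B_∞^n = [−1,1]^n, and let Eₙ be a Haar-random kₙ-dimensional subspace of ℝⁿ, independent of Xₙ, where kₙ ∈ {1,…,n}, kₙ → ∞ and kₙ/n → λ ∈ [0,1] as n → ∞. Then √3 · ‖P_{Eₙ}Xₙ‖₂ − √kₙ converges in distribution, as n → ∞, to a centered Gaussian random variable with variance σ²(∞,λ) := 1/2 − 3λ/10. -/
open MeasureTheory ProbabilityTheory Filter Topology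

noncomputable section

/-- `A` is an orthogonal matrix (columns orthonormal, i.e. `Aᵀ A = 1`). -/
def IsOrthMat {n : ℕ} (A : Fin n → Fin n → ℝ) : Prop :=
  ∀ i j, (∑ l, A l i * A l j) = if i = j then (1 : ℝ) else 0

/-- Matrix multiplication of square matrices given as functions. -/
def matMul {n : ℕ} (A B : Fin n → Fin n → ℝ) : Fin n → Fin n → ℝ :=
  fun i j => ∑ l, A i l * B l j

/-- The Euclidean norm `‖P_E x‖₂` of the orthogonal projection of `x` onto the subspace
`E = A · span(e₀, …, e_{k-1})` for an orthogonal matrix `A`, i.e. `‖A D_k Aᵀ x‖₂` where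
`D_k` is the diagonal matrix with `1` in the first `k` diagonal entries and `0` elsewhere. -/
def projEuclNorm {n : ℕ} (A : Fin n → Fin n → ℝ) (k : ℕ) (x : Fin n → ℝ) : ℝ :=
  Real.sqrt (∑ i, (∑ l : Fin n, if (l : ℕ) < k then A i l * (∑ j, A j l * x j) else 0) ^ 2)
/-- The cube `[-1,1]^n` as a subset of `Fin n → ℝ`. -/
def cube (n : ℕ) : Set (Fin n → ℝ) := {x | ∀ i, |x i| ≤ 1}

/-- The uniform probability distribution on the cube `[-1,1]^n`:
normalized Lebesgue measure restricted to the cube. -/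
def unifCube (n : ℕ) : Measure (Fin n → ℝ) :=
  (volume (cube n))⁻¹ • volume.restrict (cube n)

/-- The product `Aᵀ x` of the transpose of a square matrix and a vector. -/
def transposeMulVec {n : ℕ} (A : Fin n → Fin n → ℝ) (x : Fin n → ℝ) : Fin n → ℝ :=
  fun l => ∑ j, A j l * x j

lemma transposeMulVec_smul {n : ℕ} (A : Fin n → Fin n → ℝ) (c : ℝ) (x : Fin n → ℝ) :
    transposeMulVec A (c • x) = c • transposeMulVec A x := by
  ext l
  simp only [transposeMulVec, Pi.smul_apply, smul_eq_mul, Finset.mul_sum]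
  exact Finset.sum_congr rfl fun j _ => by ring

lemma measurable_transposeMulVec {n : ℕ} :
    Measurable fun p : (Fin n → Fin n → ℝ) × (Fin n → ℝ) => transposeMulVec p.1 p.2 := by
  refine measurable_pi_lambda _ fun l => ?_
  unfold transposeMulVec
  fun_prop

lemma IsOrthMat.mem_orthogonalGroup {n : ℕ} {A : Fin n → Fin n → ℝ} (hA : IsOrthMat A) :
    Matrix.of A ∈ Matrix.orthogonalGroup (Fin n) ℝ := by
  rw [Matrix.mem_orthogonalGroup_iff']
  ext i j
  simp [Matrix.mul_apply, Matrix.one_apply, hA i j]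

lemma IsOrthMat.sum_mul_row {n : ℕ} {A : Fin n → Fin n → ℝ} (hA : IsOrthMat A) (i j : Fin n) :
    ∑ l, A i l * A j l = if i = j then (1 : ℝ) else 0 := by
  have h := (Matrix.mem_orthogonalGroup_iff _ _).1 hA.mem_orthogonalGroup
  simpa [Matrix.mul_apply, Matrix.one_apply] using congrFun (congrFun h i) j

lemma sum_sq_sum_mul_eq {n : ℕ} {B : Fin n → Fin n → ℝ}
    (hB : ∀ i j, ∑ l, B l i * B l j = if i = j then (1 : ℝ) else 0) (v : Fin n → ℝ) :
    ∑ i, (∑ l, B i l * v l) ^ 2 = ∑ l, v l ^ 2 := by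
  calc ∑ i, (∑ l, B i l * v l) ^ 2
      = ∑ i, ∑ l, ∑ m, (B i l * B i m) * (v l * v m) := by
        refine Finset.sum_congr rfl fun i _ => ?_
        rw [sq, Finset.sum_mul_sum]
        exact Finset.sum_congr rfl fun l _ => Finset.sum_congr rfl fun m _ => by ring
    _ = ∑ l, ∑ m, (∑ i, B i l * B i m) * (v l * v m) := by
        rw [Finset.sum_comm]
        refine Finset.sum_congr rfl fun l _ => ?_
        rw [Finset.sum_comm]
        exact Finset.sum_congr rfl fun m _ => by rw [Finset.sum_mul]
    _ = ∑ l, v l ^ 2 := by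
        simp [hB, sq]

lemma IsOrthMat.sum_sq_transposeMulVec {n : ℕ} {A : Fin n → Fin n → ℝ} (hA : IsOrthMat A)
    (x : Fin n → ℝ) : ∑ l, transposeMulVec A x l ^ 2 = ∑ l, x l ^ 2 :=
  sum_sq_sum_mul_eq (B := fun l j => A j l) hA.sum_mul_row x

/-- The Euclidean norm of the first `k` coordinates of a vector. -/
def initialNorm {n : ℕ} (k : ℕ) (y : Fin n → ℝ) : ℝ :=
  √(∑ l : Fin n, if (l : ℕ) < k then y l ^ 2 else 0)

lemma measurable_initialNorm {n : ℕ} (k : ℕ) : Measurable (initialNorm (n := n) k) := by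
  unfold initialNorm
  refine Measurable.sqrt (Finset.measurable_sum _ fun l _ => ?_)
  split_ifs <;> fun_prop

lemma IsOrthMat.projEuclNorm_eq {n : ℕ} {A : Fin n → Fin n → ℝ} (hA : IsOrthMat A) (k : ℕ)
    (x : Fin n → ℝ) : projEuclNorm A k x = initialNorm k (transposeMulVec A x) := by
  unfold projEuclNorm initialNorm
  congr 1
  have h := sum_sq_sum_mul_eq hA fun l : Fin n => if (l : ℕ) < k then transposeMulVec A x l else 0
  simp only [mul_ite, mul_zero, ite_pow, ne_eq, OfNat.ofNat_ne_zero, not_false_eq_true,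
    zero_pow] at h
  exact h

/-- Two vectors of the same Euclidean length are exchanged by a Householder reflection. -/
lemma exists_isOrthMat_transposeMulVec_eq {n : ℕ} {x y : Fin n → ℝ}
    (hxy : ∑ i, x i ^ 2 = ∑ i, y i ^ 2) :
    ∃ B : Fin n → Fin n → ℝ, IsOrthMat B ∧ transposeMulVec B x = y := by
  obtain rfl | hne := eq_or_ne x y
  · refine ⟨fun i j => if i = j then 1 else 0, fun i j => by simp [eq_comm], ?_⟩
    ext l
    simp [transposeMulVec]
  set s : ℝ := ∑ i, (x i - y i) ^ 2 with hs
  have hs0 : s ≠ 0 := by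
    intro h
    refine hne (funext fun i => ?_)
    have := (Finset.sum_eq_zero_iff_of_nonneg fun i _ => sq_nonneg (x i - y i)).1 h i
      (Finset.mem_univ i)
    exact sub_eq_zero.1 (pow_eq_zero_iff two_ne_zero |>.1 this)
  have hsx : 2 * ∑ i, (x i - y i) * x i = s := by
    have : s = 2 * (∑ i, (x i - y i) * x i) - ∑ i, x i ^ 2 + ∑ i, y i ^ 2 := by
      rw [hs, Finset.mul_sum, ← Finset.sum_sub_distrib, ← Finset.sum_add_distrib]
      exact Finset.sum_congr rfl fun i _ => by ring
    linarith
  refine ⟨fun i j => (if i = j then 1 else 0) - 2 / s * ((x i - y i) * (x j - y j)),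
    fun i j => ?_, ?_⟩
  · have : ∀ l, ((if l = i then (1 : ℝ) else 0) - 2 / s * ((x l - y l) * (x i - y i))) *
        ((if l = j then 1 else 0) - 2 / s * ((x l - y l) * (x j - y j))) =
        (if l = i then (if l = j then (1 : ℝ) else 0) else 0)
          - (if l = i then 2 / s * ((x l - y l) * (x j - y j)) else 0)
          - (if l = j then 2 / s * ((x l - y l) * (x i - y i)) else 0)
          + (x l - y l) ^ 2 * ((2 / s) ^ 2 * ((x i - y i) * (x j - y j))) := by
      intro l
      split_ifs <;> ring
    simp only [this, Finset.sum_add_distrib, Finset.sum_sub_distrib, Finset.sum_ite_eq',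
      Finset.mem_univ, if_true, ← Finset.sum_mul]
    rw [← hs]
    field_simp
    ring
  · ext l
    have : ∀ j, ((if j = l then (1 : ℝ) else 0) - 2 / s * ((x j - y j) * (x l - y l))) * x j =
        (if j = l then x j else 0) - (x j - y j) * x j * (2 / s * (x l - y l)) := by
      intro j
      split_ifs <;> ring
    simp only [transposeMulVec, this, Finset.sum_sub_distrib, Finset.sum_ite_eq',
      Finset.mem_univ, if_true, ← Finset.sum_mul]
    have h2 : ∑ i, (x i - y i) * x i = s / 2 := by linarith
    rw [h2]
    field_simp
    ring

/-- The first columns of a Haar distributed orthogonal matrix act on a fixed vector as on a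
normalized sample of any rotation invariant law. -/
lemma integral_transposeMulVec_haar {n : ℕ} {μ : Measure (Fin n → Fin n → ℝ)}
    [IsProbabilityMeasure μ] {γ : Measure (Fin n → ℝ)} [IsProbabilityMeasure γ]
    (hμ : ∀ᵐ A ∂μ, IsOrthMat A)
    (hinv : ∀ B : Fin n → Fin n → ℝ, IsOrthMat B → μ.map (matMul B) = μ)
    (hγ : ∀ A : Fin n → Fin n → ℝ, IsOrthMat A → γ.map (transposeMulVec A) = γ)
    (hγ0 : ∀ᵐ w ∂γ, w ≠ 0) {g : (Fin n → ℝ) → ℝ} (hg : Measurable g) {C : ℝ}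
    (hgC : ∀ y, |g y| ≤ C) (x : Fin n → ℝ) :
    ∫ A, g (transposeMulVec A x) ∂μ = ∫ w, g ((√(∑ i, x i ^ 2) / √(∑ i, w i ^ 2)) • w) ∂γ := by
  have hmul (B : Fin n → Fin n → ℝ) : Measurable (matMul B) := by
    refine measurable_pi_lambda _ fun i => measurable_pi_lambda _ fun j => ?_
    unfold matMul
    fun_prop
  have hT (x : Fin n → ℝ) : Measurable fun A : Fin n → Fin n → ℝ => transposeMulVec A x :=
    measurable_transposeMulVec.comp (measurable_id.prodMk measurable_const)
  have hT' (A : Fin n → Fin n → ℝ) : Measurable (transposeMulVec A) :=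
    measurable_transposeMulVec.comp (measurable_const.prodMk measurable_id)
  have hsame {y : Fin n → ℝ} (hxy : ∑ i, x i ^ 2 = ∑ i, y i ^ 2) :
      ∫ A, g (transposeMulVec A y) ∂μ = ∫ A, g (transposeMulVec A x) ∂μ := by
    obtain ⟨B, hB, rfl⟩ := exists_isOrthMat_transposeMulVec_eq hxy
    have hgT : Measurable fun A : Fin n → Fin n → ℝ => g (transposeMulVec A x) := hg.comp (hT x)
    conv_rhs => rw [← hinv B hB]
    rw [integral_map (hmul B).aemeasurable hgT.aestronglyMeasurable]
    refine integral_congr_ae (ae_of_all _ fun A => congrArg g ?_)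
    ext l
    simp only [transposeMulVec, matMul, Finset.mul_sum, Finset.sum_mul]
    rw [Finset.sum_comm]
    exact Finset.sum_congr rfl fun i _ => Finset.sum_congr rfl fun j _ => by ring
  set G : (Fin n → ℝ) → (Fin n → ℝ) := fun w => (√(∑ i, x i ^ 2) / √(∑ i, w i ^ 2)) • w with hG
  have hGm : Measurable G := by
    rw [hG]
    fun_prop
  have hgG : Measurable fun w => g (G w) := hg.comp hGm
  have hrot : ∀ᵐ A ∂μ, ∫ w, g (transposeMulVec A (G w)) ∂γ = ∫ w, g (G w) ∂γ := by
    filter_upwards [hμ] with A hA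
    conv_rhs => rw [← hγ A hA]
    rw [integral_map (hT' A).aemeasurable hgG.aestronglyMeasurable]
    congr! 3 with w
    simp only [hG, transposeMulVec_smul, hA.sum_sq_transposeMulVec]
  calc ∫ A, g (transposeMulVec A x) ∂μ
      = ∫ w, ∫ A, g (transposeMulVec A (G w)) ∂μ ∂γ := by
        have : ∀ᵐ w ∂γ, ∫ A, g (transposeMulVec A (G w)) ∂μ =
            ∫ A, g (transposeMulVec A x) ∂μ := by
          filter_upwards [hγ0] with w hw
          refine hsame ?_
          have hw0 : 0 < ∑ i, w i ^ 2 := by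
            obtain ⟨i, hi⟩ := Function.ne_iff.1 hw
            exact Finset.sum_pos' (fun i _ => sq_nonneg _)
              ⟨i, Finset.mem_univ i, by simpa using sq_pos_of_ne_zero hi⟩
          simp only [hG, Pi.smul_apply, smul_eq_mul, mul_pow, ← Finset.mul_sum, div_pow]
          rw [Real.sq_sqrt (Finset.sum_nonneg fun i _ => sq_nonneg _), Real.sq_sqrt hw0.le,
            div_mul_cancel₀ _ hw0.ne']
        rw [integral_congr_ae this]
        simp
    _ = ∫ A, ∫ w, g (transposeMulVec A (G w)) ∂γ ∂μ := by
        refine integral_integral_swap (Integrable.of_bound ?_ C (ae_of_all _ fun p => hgC _))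
        exact (hg.comp (measurable_transposeMulVec.comp
          (measurable_snd.prodMk (hGm.comp measurable_fst)))).aestronglyMeasurable
    _ = ∫ w, g (G w) ∂γ := by
        rw [integral_congr_ae hrot]
        simp

lemma map_transposeMulVec_pi_gaussianReal {n : ℕ} {A : Fin n → Fin n → ℝ} (hA : IsOrthMat A) :
    (Measure.pi fun _ : Fin n => gaussianReal 0 1).map (transposeMulVec A) =
      Measure.pi fun _ : Fin n => gaussianReal 0 1 := by
  let L : EuclideanSpace ℝ (Fin n) →ₗᵢ[ℝ] EuclideanSpace ℝ (Fin n) :=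
    { toFun := fun v => WithLp.toLp 2 (transposeMulVec A v.ofLp)
      map_add' := fun v w => by
        ext l
        simp [transposeMulVec, mul_add, Finset.sum_add_distrib]
      map_smul' := fun c v => by
        ext l
        simp [transposeMulVec_smul]
      norm_map' := fun v => by
        simp [EuclideanSpace.norm_eq, hA.sum_sq_transposeMulVec] }
  let e := L.toLinearIsometryEquiv rfl
  have hT : Measurable (transposeMulVec A) :=
    measurable_transposeMulVec.comp (measurable_const.prodMk measurable_id)
  have h1 := map_pi_eq_stdGaussian (ι := Fin n)
  have h2 := stdGaussian_map e
  rw [← h1, Measure.map_map (by fun_prop) (by fun_prop)] at h2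
  have h3 := congrArg (Measure.map (WithLp.ofLp)) h2
  rw [Measure.map_map (by fun_prop) (by fun_prop),
    Measure.map_map (by fun_prop) (by fun_prop)] at h3
  have h4 : (WithLp.ofLp : EuclideanSpace ℝ (Fin n) → Fin n → ℝ) ∘ WithLp.toLp 2 = id := rfl
  rw [h4, Measure.map_id] at h3
  exact h3

lemma norm_pow_sub_pow_le_of_norm_le_one {a b : ℂ} (ha : ‖a‖ ≤ 1) (hb : ‖b‖ ≤ 1) (m : ℕ) :
    ‖a ^ m - b ^ m‖ ≤ m * ‖a - b‖ := by
  induction m with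
  | zero => simp
  | succ m ih =>
    have h1 : a ^ (m + 1) - b ^ (m + 1) = (a ^ m - b ^ m) * a + b ^ m * (a - b) := by ring
    have h2 : ‖b ^ m‖ ≤ 1 := by
      rw [norm_pow]
      exact pow_le_one₀ (norm_nonneg _) hb
    calc ‖a ^ (m + 1) - b ^ (m + 1)‖ ≤ ‖a ^ m - b ^ m‖ * ‖a‖ + ‖b ^ m‖ * ‖a - b‖ := by
          rw [h1, ← norm_mul, ← norm_mul]
          exact norm_add_le _ _
      _ ≤ ‖a ^ m - b ^ m‖ * 1 + 1 * ‖a - b‖ := by gcongr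
      _ ≤ m * ‖a - b‖ + ‖a - b‖ := by linarith
      _ = (m + 1 : ℕ) * ‖a - b‖ := by push_cast; ring

lemma tendsto_charFun_pow_of_tendsto {E : Type*} [MeasurableSpace E] {P : Measure E}
    [IsProbabilityMeasure P] {X : E → ℝ} (hX : Measurable X) (h0 : P[X] = 0)
    (h1 : P[X ^ 2] = 1) {m : ℕ → ℕ} {a : ℕ → ℝ} {s : ℝ} (ha : Tendsto a atTop (𝓝 0))
    (hma : Tendsto (fun n => m n * a n ^ 2) atTop (𝓝 s)) (t : ℝ) :
    Tendsto (fun n => charFun (P.map X) (a n * t) ^ m n) atTop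
      (𝓝 (Complex.exp (-(s * t ^ 2 / 2) : ℝ))) := by
  have := Measure.isProbabilityMeasure_map (μ := P) hX.aemeasurable
  have hgauss (u : ℝ) :
      charFun ((gaussianReal 0 1).map id) u = Complex.exp (-(u ^ 2 / 2) : ℝ) := by
    rw [Measure.map_id, charFun_gaussianReal]
    push_cast
    ring_nf
  have hG0 : (gaussianReal 0 1)[id] = 0 := integral_id_gaussianReal
  have hG1 : (gaussianReal 0 1)[id ^ 2] = 1 := by
    have h := variance_id_gaussianReal (μ := 0) (v := 1)
    rw [variance_of_integral_eq_zero aemeasurable_id hG0] at h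
    simpa using h
  have hat : Tendsto (fun n => a n * t) atTop (𝓝 0) := by simpa using ha.mul_const t
  have hdiff : (fun u => charFun (P.map X) u - charFun ((gaussianReal 0 1).map id) u)
      =o[𝓝 0] fun u => u ^ 2 := by
    refine ((taylor_charFun_two hX.aemeasurable h0 h1).sub
      (taylor_charFun_two aemeasurable_id hG0 hG1)).congr_left fun u => ?_
    ring
  have hlittle : Tendsto (fun n => m n * ‖charFun (P.map X) (a n * t) -
      charFun ((gaussianReal 0 1).map id) (a n * t)‖) atTop (𝓝 0) := by
    have hO : (fun n => (m n : ℝ) * (a n * t) ^ 2) =O[atTop] fun _ => (1 : ℝ) := by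
      refine Tendsto.isBigO_one ℝ (c := s * t ^ 2) ?_
      refine (hma.mul_const (t ^ 2)).congr fun n => by ring
    have ho := (hdiff.comp_tendsto hat).norm_left
    have := (Asymptotics.isBigO_refl (fun n => (m n : ℝ)) atTop).mul_isLittleO ho
    exact (Asymptotics.isLittleO_one_iff ℝ).1 (this.trans_isBigO hO)
  have hlim : Tendsto (fun n => charFun ((gaussianReal 0 1).map id) (a n * t) ^ m n) atTop
      (𝓝 (Complex.exp (-(s * t ^ 2 / 2) : ℝ))) := by
    have : Tendsto (fun n => (-(m n * a n ^ 2 * t ^ 2 / 2) : ℝ)) atTop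
        (𝓝 (-(s * t ^ 2 / 2))) := ((hma.mul_const _).div_const _).neg
    refine ((Complex.continuous_exp.comp Complex.continuous_ofReal).tendsto _ |>.comp this).congr
      fun n => ?_
    rw [hgauss, ← Complex.exp_nat_mul]
    simp only [Function.comp_apply]
    push_cast
    ring_nf
  have hzero : Tendsto (fun n => charFun (P.map X) (a n * t) ^ m n -
      charFun ((gaussianReal 0 1).map id) (a n * t) ^ m n) atTop (𝓝 0) := by
    have : IsProbabilityMeasure ((gaussianReal 0 1).map id) := by
      rw [Measure.map_id]; infer_instance
    refine squeeze_zero_norm (fun n => ?_) hlittle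
    exact norm_pow_sub_pow_le_of_norm_le_one (norm_charFun_le_one _) (norm_charFun_le_one _) _
  simpa using hzero.add hlim

lemma charFun_map_sum_infinitePi {E : Type*} [MeasurableSpace E] {ρ : Measure E}
    [IsProbabilityMeasure ρ] {X : E → ℝ} (hX : Measurable X) (c : ℕ → ℝ) (n : ℕ) (t : ℝ) :
    charFun ((Measure.infinitePi fun _ : ℕ => ρ).map
      fun ω => ∑ i ∈ Finset.range n, c i * X (ω i)) t =
      ∏ i ∈ Finset.range n, charFun (ρ.map X) (c i * t) := by
  have hind : iIndepFun (fun i (ω : ℕ → E) => c i * X (ω i)) (Measure.infinitePi fun _ => ρ) :=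
    iIndepFun_infinitePi (X := fun i x => c i * X x) fun i => by fun_prop
  rw [(hind.restrict _).charFun_map_fun_finsetSum_eq_prod fun i _ =>
      Measurable.aemeasurable (by fun_prop),
    Finset.prod_apply]
  refine Finset.prod_congr rfl fun i _ => ?_
  rw [charFun_map_mul_comp (Measurable.aemeasurable (by fun_prop))]
  congr 1
  rw [← Function.comp_def X, ← Measure.map_map hX (by fun_prop), Measure.infinitePi_map_eval]

/-- A central limit theorem for weighted sums of two independent i.i.d. families, where the weights
in the second family take one value before the index `k n` and another one after it. -/
theorem tendstoInDistribution_weighted_sum {E F : Type*} [MeasurableSpace E] [MeasurableSpace F]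
    {ρ : Measure E} [IsProbabilityMeasure ρ] {τ : Measure F} [IsProbabilityMeasure τ]
    {X : E → ℝ} {Y : F → ℝ} (hX : Measurable X) (hX0 : ρ[X] = 0) (hX1 : ρ[X ^ 2] = 1)
    (hY : Measurable Y) (hY0 : τ[Y] = 0) (hY1 : τ[Y ^ 2] = 1)
    {k : ℕ → ℕ} (hk : ∀ᶠ n in atTop, k n ≤ n) {α β γ : ℕ → ℝ} {a b c v : ℝ}
    (hα : Tendsto α atTop (𝓝 0)) (hβ : Tendsto β atTop (𝓝 0)) (hγ : Tendsto γ atTop (𝓝 0))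
    (ha : Tendsto (fun n => n * α n ^ 2) atTop (𝓝 a))
    (hb : Tendsto (fun n => k n * β n ^ 2) atTop (𝓝 b))
    (hc : Tendsto (fun n => ((n - k n : ℕ) : ℝ) * γ n ^ 2) atTop (𝓝 c))
    (hv : a + b + c = v) :
    TendstoInDistribution (fun (n : ℕ) (ω : (ℕ → E) × (ℕ → F)) =>
        ∑ i ∈ Finset.range n, α n * X (ω.1 i) +
          ∑ i ∈ Finset.range n, (if i < k n then β n else γ n) * Y (ω.2 i)) atTop id
      (fun _ => (Measure.infinitePi fun _ => ρ).prod (Measure.infinitePi fun _ => τ))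
      (gaussianReal 0 v.toNNReal) where
  forall_aemeasurable n := by fun_prop
  tendsto := by
    refine ProbabilityMeasure.tendsto_iff_tendsto_charFun.2 fun t => ?_
    have hv0 : 0 ≤ v := by
      have h1 := ge_of_tendsto' ha fun n => by positivity
      have h2 := ge_of_tendsto' hb fun n => by positivity
      have h3 := ge_of_tendsto' hc fun n => by positivity
      linarith
    have hlim := ((tendsto_charFun_pow_of_tendsto hX hX0 hX1 (m := fun n => n) hα ha t).mul
      (tendsto_charFun_pow_of_tendsto hY hY0 hY1 hβ hb t)).mul
      (tendsto_charFun_pow_of_tendsto hY hY0 hY1 hγ hc t)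
    have hexp : charFun ((gaussianReal 0 v.toNNReal).map id) t =
        Complex.exp (-(a * t ^ 2 / 2) : ℝ) * Complex.exp (-(b * t ^ 2 / 2) : ℝ) *
          Complex.exp (-(c * t ^ 2 / 2) : ℝ) := by
      rw [Measure.map_id, charFun_gaussianReal, ← Complex.exp_add, ← Complex.exp_add,
        Real.coe_toNNReal _ hv0, ← hv]
      push_cast
      ring_nf
    simp only [ProbabilityMeasure.coe_mk]
    rw [hexp]
    refine hlim.congr' ?_
    filter_upwards [hk] with n hn
    have hind := indepFun_prod (μ := Measure.infinitePi fun _ : ℕ => ρ)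
      (ν := Measure.infinitePi fun _ : ℕ => τ)
      (X := fun ω => ∑ i ∈ Finset.range n, α n * X (ω i))
      (Y := fun ω => ∑ i ∈ Finset.range n, (if i < k n then β n else γ n) * Y (ω i))
      (by fun_prop) (by fun_prop)
    rw [hind.charFun_map_fun_add_eq_mul (by fun_prop) (by fun_prop), Pi.mul_apply]
    have hfst := (Measure.map_map (μ := (Measure.infinitePi fun _ : ℕ => ρ).prod
      (Measure.infinitePi fun _ : ℕ => τ))
      (show Measurable fun ω : ℕ → E => ∑ i ∈ Finset.range n, α n * X (ω i) by fun_prop)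
      measurable_fst)
    have hsnd := (Measure.map_map (μ := (Measure.infinitePi fun _ : ℕ => ρ).prod
      (Measure.infinitePi fun _ : ℕ => τ))
      (show Measurable fun ω : ℕ → F =>
        ∑ i ∈ Finset.range n, (if i < k n then β n else γ n) * Y (ω i) by fun_prop)
      measurable_snd)
    rw [measurePreserving_fst.map_eq] at hfst
    rw [measurePreserving_snd.map_eq] at hsnd
    simp only [Function.comp_def] at hfst hsnd
    rw [← hfst, ← hsnd, charFun_map_sum_infinitePi hX (fun _ => α n),
      charFun_map_sum_infinitePi hY (fun i => if i < k n then β n else γ n),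
      Finset.prod_const, Finset.card_range, mul_assoc,
      ← Finset.prod_range_mul_prod_Ico _ hn,
      Finset.prod_congr (s₁ := Finset.range (k n)) rfl fun i hi => by
        rw [if_pos (Finset.mem_range.1 hi)],
      Finset.prod_congr (s₁ := Finset.Ico (k n) n) rfl fun i hi => by
        rw [if_neg (not_lt.2 (Finset.mem_Ico.1 hi).1)]]
    simp

/-- The uniform distribution on `[-1, 1]`. -/
def unifInterval : Measure ℝ := (2 : ENNReal)⁻¹ • volume.restrict (Set.Icc (-1) 1)

instance : IsProbabilityMeasure unifInterval := by
  refine ⟨?_⟩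
  simp only [unifInterval, Measure.smul_apply, Measure.restrict_apply_univ, Real.volume_Icc,
    smul_eq_mul]
  norm_num
  exact ENNReal.inv_mul_cancel (by norm_num) (by norm_num)

lemma integral_unifInterval (f : ℝ → ℝ) :
    ∫ x, f x ∂unifInterval = (∫ x in (-1)..1, f x) / 2 := by
  rw [unifInterval, integral_smul_measure, intervalIntegral.integral_of_le (by norm_num),
    integral_Icc_eq_integral_Ioc]
  simp
  ring

lemma unifCube_eq_pi (n : ℕ) : unifCube n = Measure.pi fun _ : Fin n => unifInterval := by
  have hcube : cube n = Set.univ.pi fun _ : Fin n => Set.Icc (-1 : ℝ) 1 := by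
    ext x
    simp only [cube, abs_le, Set.mem_ofPred_eq, Set.mem_univ_pi, Set.mem_Icc]
  have hvol : volume (cube n) = 2 ^ n := by
    rw [hcube, volume_pi_pi]
    norm_num
  refine (Measure.pi_eq fun s hs => ?_).symm
  rw [unifCube, hvol, hcube, volume_pi, Measure.restrict_pi_pi, Measure.smul_apply,
    Measure.pi_pi]
  simp only [unifInterval, Measure.smul_apply, smul_eq_mul, Finset.prod_mul_distrib,
    Finset.prod_const, Finset.card_univ, Fintype.card_fin]
  rw [ENNReal.inv_pow]

lemma map_restrict_infinitePi {E : Type*} [MeasurableSpace E] {ρ : Measure E}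
    [IsProbabilityMeasure ρ] (n : ℕ) :
    (Measure.infinitePi fun _ : ℕ => ρ).map (fun ω (i : Fin n) => ω i) =
      Measure.pi fun _ : Fin n => ρ := by
  rw [← Measure.infinitePi_eq_pi]
  exact Measure.map_infinitePi_infinitePi_of_inj Fin.val_injective

lemma integral_pow_four_gaussianReal : ∫ x, x ^ 4 ∂(gaussianReal 0 1) = 3 := by
  have h := iteratedDeriv_mgf_zero (X := id) (μ := gaussianReal 0 1) (by simp) 4
  have hm : mgf id (gaussianReal 0 1) = fun t => Real.exp (t ^ 2 / 2) := by
    rw [mgf_id_gaussianReal]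
    simp
  have hd (p : ℝ → ℝ) (p' : ℝ → ℝ) (hp : ∀ t, HasDerivAt p (p' t) t) :
      deriv (fun t => p t * Real.exp (t ^ 2 / 2)) =
        fun t => (p' t + t * p t) * Real.exp (t ^ 2 / 2) := by
    ext t
    have h1 : HasDerivAt (fun t : ℝ => t ^ 2 / 2) t t := by
      simpa using ((hasDerivAt_id t).pow 2).div_const 2
    refine ((hp t).mul h1.exp).deriv.trans ?_
    ring
  have h1 : deriv (fun t : ℝ => Real.exp (t ^ 2 / 2)) = fun t => t * Real.exp (t ^ 2 / 2) := by
    simpa using hd (fun _ => 1) (fun _ => 0) fun t => hasDerivAt_const t 1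
  have h2 := hd (fun t => t) (fun _ => 1) fun t => hasDerivAt_id t
  have h3 := hd (fun t => 1 + t * t) (fun t => 2 * t) fun t => by
    simpa [two_mul] using ((hasDerivAt_id t).mul (hasDerivAt_id t)).const_add 1
  have h4 := hd (fun t => 2 * t + t * (1 + t * t)) (fun t => 3 + 3 * t ^ 2) fun t => by
    have h := ((hasDerivAt_id t).const_mul 3).add ((hasDerivAt_id t).pow 3)
    refine (h.congr_deriv (by simp)).congr_of_eventuallyEq (Eventually.of_forall fun u => ?_)
    simp only [Pi.add_apply, Pi.pow_apply, id]
    ring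
  simp only [iteratedDeriv_succ, iteratedDeriv_zero, hm, h1, h2, h3, h4] at h
  simpa using h.symm

lemma integral_sq_gaussianReal : ∫ x, x ^ 2 ∂(gaussianReal 0 1) = 1 := by
  have h := variance_id_gaussianReal (μ := 0) (v := 1)
  rw [variance_of_integral_eq_zero aemeasurable_id integral_id_gaussianReal] at h
  simpa using h

lemma integrable_pow_gaussianReal (m : ℕ) : Integrable (fun x => x ^ m) (gaussianReal 0 1) := by
  refine (memLp_id_gaussianReal (μ := 0) (v := 1) m).integrable_norm_pow'.mono'
    (by fun_prop) (ae_of_all _ fun x => ?_)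
  simp

lemma ae_tendsto_average_infinitePi {E : Type*} [MeasurableSpace E] {ρ : Measure E}
    [IsProbabilityMeasure ρ] {g : E → ℝ} (hg : Measurable g) (hint : Integrable g ρ) :
    ∀ᵐ ω ∂Measure.infinitePi fun _ : ℕ => ρ,
      Tendsto (fun n : ℕ => (∑ i ∈ Finset.range n, g (ω i)) / n) atTop (𝓝 (∫ x, g x ∂ρ)) := by
  have hpres (i : ℕ) : MeasurePreserving (fun ω : ℕ → E => ω i) (Measure.infinitePi fun _ => ρ) ρ :=
    measurePreserving_eval_infinitePi _ i
  have h := strong_law_ae_real (μ := Measure.infinitePi fun _ : ℕ => ρ) (fun i ω => g (ω i))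
    ((hpres 0).integrable_comp_of_integrable hint)
    (fun i j hij => (iIndepFun_infinitePi (X := fun _ : ℕ => g) fun _ => hg).indepFun hij)
    fun i => ⟨Measurable.aemeasurable (by fun_prop), Measurable.aemeasurable (by fun_prop), by
      rw [← Function.comp_def g, ← Function.comp_def g, ← Measure.map_map hg (by fun_prop),
        ← Measure.map_map hg (by fun_prop), (hpres i).map_eq, (hpres 0).map_eq]⟩
  have h0 : ∫ ω, g (ω 0) ∂(Measure.infinitePi fun _ : ℕ => ρ) = ∫ x, g x ∂ρ := by
    rw [← (hpres 0).map_eq,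
      integral_map (hpres 0).measurable.aemeasurable hg.aestronglyMeasurable, (hpres 0).map_eq]
  rwa [h0] at h

lemma tendstoInMeasure_of_tendstoInDistribution_const {Ω Ω' : Type*} [MeasurableSpace Ω]
    [MeasurableSpace Ω'] {μ : Measure Ω} [IsProbabilityMeasure μ] {μ' : Measure Ω'}
    [IsProbabilityMeasure μ'] {U : ℕ → Ω → ℝ} {c : ℝ}
    (h : TendstoInDistribution U atTop (fun _ : Ω' => c) (fun _ => μ) μ') :
    TendstoInMeasure μ U atTop fun _ => c := by
  rw [tendstoInMeasure_iff_dist]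
  intro ε hε
  have hclosed : IsClosed {x : ℝ | ε ≤ dist x c} :=
    isClosed_le continuous_const (continuous_id.dist continuous_const)
  have hnull : (μ'.map fun _ => c) {x : ℝ | ε ≤ dist x c} = 0 := by
    simp [Measure.map_const, Measure.dirac_apply' _ hclosed.measurableSet, hε]
  have hlim := ProbabilityMeasure.tendsto_measure_of_null_frontier_of_tendsto' h.tendsto
    (E := {x : ℝ | ε ≤ dist x c}) (measure_mono_null hclosed.frontier_subset hnull)
  simp only [ProbabilityMeasure.coe_mk, hnull] at hlim
  refine hlim.congr fun n => ?_
  rw [Measure.map_apply_of_aemeasurable (h.forall_aemeasurable n) hclosed.measurableSet]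
  rfl

/-- A sequence converging in distribution times a sequence converging to zero in probability
converges to zero in probability. -/
lemma tendstoInMeasure_mul_of_tendstoInDistribution {Ω Ω' : Type*} [MeasurableSpace Ω]
    [MeasurableSpace Ω'] {μ : Measure Ω} [IsProbabilityMeasure μ] {μ' : Measure Ω'}
    [IsProbabilityMeasure μ'] {U V : ℕ → Ω → ℝ} {Z : Ω' → ℝ}
    (hU : TendstoInDistribution U atTop Z (fun _ => μ) μ')
    (hV : TendstoInMeasure μ V atTop fun _ => 0) (hVm : ∀ n, AEMeasurable (V n) μ) :
    TendstoInMeasure μ (fun n ω => U n ω * V n ω) atTop fun _ => 0 := by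
  have h := hU.continuous_comp_prodMk_of_tendstoInMeasure_const
    (g := fun x : ℝ × ℝ => x.1 * x.2) (by fun_prop) hV hVm
  simp only [mul_zero] at h
  exact tendstoInMeasure_of_tendstoInDistribution_const h

lemma tendstoInDistribution_of_ae_eventually_eq {Ω Ω' : Type*} [MeasurableSpace Ω]
    [MeasurableSpace Ω'] {μ : Measure Ω} [IsProbabilityMeasure μ] {μ' : Measure Ω'}
    [IsProbabilityMeasure μ'] {U V : ℕ → Ω → ℝ} {Z : Ω' → ℝ}
    (hU : TendstoInDistribution U atTop Z (fun _ => μ) μ') (hVm : ∀ n, Measurable (V n))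
    (h : ∀ᵐ ω ∂μ, ∀ᶠ n in atTop, V n ω = U n ω) :
    TendstoInDistribution V atTop Z (fun _ => μ) μ' := by
  refine tendstoInDistribution_of_tendstoInMeasure_sub V Z hU
    (tendstoInMeasure_of_tendsto_ae (fun n => ?_) ?_) fun n => (hVm n).aemeasurable
  · exact ((hVm n).aemeasurable.sub (hU.forall_aemeasurable n)).aestronglyMeasurable
  · filter_upwards [h] with ω hω
    refine tendsto_const_nhds.congr' ?_
    filter_upwards [hω] with n hn
    simp [hn]

/-- The random vectors and the orthogonal matrices may be replaced by explicit i.i.d. samples. -/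
lemma integral_projEuclNorm_eq {Ω : Type*} [MeasurableSpace Ω] {P : Measure Ω}
    [IsProbabilityMeasure P] {n : ℕ} (hn : n ≠ 0) {X : Ω → Fin n → ℝ} {O : Ω → Fin n → Fin n → ℝ}
    (hX : Measurable X) (hO : Measurable O) (hXlaw : Measure.map X P = unifCube n)
    (hOorth : ∀ ω, IsOrthMat (O ω))
    (hOHaar : ∀ B : Fin n → Fin n → ℝ, IsOrthMat B →
      Measure.map (fun ω => matMul B (O ω)) P = Measure.map O P)
    (hXO : IndepFun X O P) (k : ℕ) {g : ℝ → ℝ} (hg : Measurable g) {C : ℝ}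
    (hgC : ∀ y, |g y| ≤ C) :
    ∫ ω, g (projEuclNorm (O ω) k (X ω)) ∂P =
      ∫ ω : (ℕ → ℝ) × (ℕ → ℝ), g (initialNorm k
        ((√(∑ i : Fin n, ω.1 i ^ 2) / √(∑ i : Fin n, ω.2 i ^ 2)) • fun i : Fin n => ω.2 i))
      ∂((Measure.infinitePi fun _ => unifInterval).prod
        (Measure.infinitePi fun _ => gaussianReal 0 1)) := by
  have hmul (B : Fin n → Fin n → ℝ) : Measurable (matMul B) := by
    refine measurable_pi_lambda _ fun i => measurable_pi_lambda _ fun j => ?_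
    unfold matMul
    fun_prop
  have hgn : Measurable fun y : Fin n → ℝ => g (initialNorm k y) :=
    hg.comp (measurable_initialNorm k)
  set γ := Measure.pi fun _ : Fin n => gaussianReal 0 1 with hγ
  have : IsProbabilityMeasure (P.map O) := Measure.isProbabilityMeasure_map hO.aemeasurable
  have : IsProbabilityMeasure (P.map X) := Measure.isProbabilityMeasure_map hX.aemeasurable
  have horth : ∀ᵐ A ∂(P.map O), IsOrthMat A := by
    refine (ae_map_iff hO.aemeasurable ?_).2 (ae_of_all _ hOorth)
    simp only [IsOrthMat, Set.ofPred_forall]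
    refine MeasurableSet.iInter fun i => MeasurableSet.iInter fun j =>
      measurableSet_eq_fun (by fun_prop) measurable_const
  have hinv (B : Fin n → Fin n → ℝ) (hB : IsOrthMat B) : (P.map O).map (matMul B) = P.map O := by
    rw [Measure.map_map (hmul B) hO]
    exact hOHaar B hB
  have hγ0 : ∀ᵐ w ∂γ, w ≠ 0 := by
    have : NullSingletonClass (gaussianReal 0 1) := nullSingletonClass_gaussianReal one_ne_zero
    filter_upwards [Measure.ae_eval_ne (μ := fun _ : Fin n => gaussianReal 0 1)
      ⟨0, Nat.pos_of_ne_zero hn⟩ 0] with w hw h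
    exact hw (by rw [h]; rfl)
  have hjoint : Measurable fun p : (Fin n → ℝ) × (Fin n → Fin n → ℝ) =>
      g (initialNorm k (transposeMulVec p.2 p.1)) :=
    hgn.comp (measurable_transposeMulVec.comp measurable_swap)
  have hscaled : Measurable fun p : (Fin n → ℝ) × (Fin n → ℝ) =>
      g (initialNorm k ((√(∑ i, p.1 i ^ 2) / √(∑ i, p.2 i ^ 2)) • p.2)) :=
    hgn.comp (by fun_prop)
  have hres : Measurable (Prod.map (fun (ω : ℕ → ℝ) (i : Fin n) => ω i)
      fun (ω : ℕ → ℝ) (i : Fin n) => ω i) :=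
    Measurable.prodMap (by fun_prop) (by fun_prop)
  calc ∫ ω, g (projEuclNorm (O ω) k (X ω)) ∂P
      = ∫ ω, g (initialNorm k (transposeMulVec (O ω) (X ω))) ∂P := by
        simp_rw [(hOorth _).projEuclNorm_eq]
    _ = ∫ p, g (initialNorm k (transposeMulVec p.2 p.1)) ∂((P.map X).prod (P.map O)) := by
        rw [← (indepFun_iff_map_prod_eq_prod_map_map hX.aemeasurable hO.aemeasurable).1 hXO,
          integral_map (hX.prodMk hO).aemeasurable hjoint.aestronglyMeasurable]
    _ = ∫ x, ∫ A, g (initialNorm k (transposeMulVec A x)) ∂(P.map O) ∂(P.map X) :=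
        integral_prod _ (Integrable.of_bound hjoint.aestronglyMeasurable C
          (ae_of_all _ fun p => hgC _))
    _ = ∫ x, ∫ w, g (initialNorm k ((√(∑ i, x i ^ 2) / √(∑ i, w i ^ 2)) • w)) ∂γ ∂(P.map X) :=
        integral_congr_ae (ae_of_all _ fun x => integral_transposeMulVec_haar horth hinv
          (fun A hA => map_transposeMulVec_pi_gaussianReal hA) hγ0 hgn (fun y => hgC _) x)
    _ = ∫ p, g (initialNorm k ((√(∑ i, p.1 i ^ 2) / √(∑ i, p.2 i ^ 2)) • p.2))
          ∂((P.map X).prod γ) :=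
        (integral_prod _ (Integrable.of_bound hscaled.aestronglyMeasurable C
          (ae_of_all _ fun p => hgC _))).symm
    _ = _ := by
        rw [hXlaw, unifCube_eq_pi, hγ, ← map_restrict_infinitePi, ← map_restrict_infinitePi,
          Measure.map_prod_map _ _ (by fun_prop) (by fun_prop),
          integral_map hres.aemeasurable hscaled.aestronglyMeasurable]
        rfl

/-- The mean of the squares of the first `m` terms of a sequence. -/
def meanSq (m : ℕ) (u : ℕ → ℝ) : ℝ := (∑ i ∈ Finset.range m, u i ^ 2) / m

@[fun_prop]
lemma measurable_meanSq (m : ℕ) : Measurable (meanSq m) := by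
  unfold meanSq
  fun_prop

lemma meanSq_nonneg (m : ℕ) (u : ℕ → ℝ) : 0 ≤ meanSq m u := by
  unfold meanSq
  positivity

lemma sum_range_sq_sub_one {m : ℕ} (hm : m ≠ 0) (u : ℕ → ℝ) :
    ∑ i ∈ Finset.range m, (u i ^ 2 - 1) = m * (meanSq m u - 1) := by
  have : (m : ℝ) ≠ 0 := Nat.cast_ne_zero.2 hm
  rw [Finset.sum_sub_distrib, meanSq]
  simp
  field_simp

lemma sum_range_three_mul_sq_sub_one {m : ℕ} (hm : m ≠ 0) (u : ℕ → ℝ) :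
    ∑ i ∈ Finset.range m, (3 * u i ^ 2 - 1) = m * (3 * meanSq m u - 1) := by
  have : (m : ℝ) ≠ 0 := Nat.cast_ne_zero.2 hm
  rw [Finset.sum_sub_distrib, meanSq, ← Finset.mul_sum]
  simp
  field_simp

lemma sum_range_ite_mul {k n : ℕ} (hkn : k ≤ n) (b c : ℝ) (u : ℕ → ℝ) :
    ∑ i ∈ Finset.range n, (if i < k then b else c) * u i =
      (b - c) * ∑ i ∈ Finset.range k, u i + c * ∑ i ∈ Finset.range n, u i := by
  rw [← Finset.sum_range_add_sum_Ico u hkn, ← Finset.sum_range_add_sum_Ico _ hkn,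
    Finset.sum_congr (s₁ := Finset.range k) rfl (g := fun i => b * u i) fun i hi => by
      rw [if_pos (Finset.mem_range.1 hi)],
    Finset.sum_congr (s₁ := Finset.Ico k n) rfl (g := fun i => c * u i) fun i hi => by
      rw [if_neg (Finset.mem_Ico.1 hi).1.not_gt], ← Finset.mul_sum, ← Finset.mul_sum]
  ring

lemma sqrt_three_mul_initialNorm_sub {k n : ℕ} (hk : k ≠ 0) (hkn : k ≤ n) (x w : ℕ → ℝ) :
    √3 * initialNorm k ((√(∑ i : Fin n, x i ^ 2) / √(∑ i : Fin n, w i ^ 2)) •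
        fun i : Fin n => w i) - √k =
      √k * (√(3 * meanSq n x * meanSq k w / meanSq n w) - 1) := by
  have hk0 : (k : ℝ) ≠ 0 := Nat.cast_ne_zero.2 hk
  have hn0 : (n : ℝ) ≠ 0 := Nat.cast_ne_zero.2 (by omega)
  have hsum : (∑ l : Fin n, if (l : ℕ) < k then
      ((√(∑ i : Fin n, x i ^ 2) / √(∑ i : Fin n, w i ^ 2)) • fun i : Fin n => w i) l ^ 2 else 0) =
      (∑ i ∈ Finset.range n, x i ^ 2) / (∑ i ∈ Finset.range n, w i ^ 2) *
        ∑ i ∈ Finset.range k, w i ^ 2 := by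
    rw [← Fin.sum_univ_eq_sum_range (fun i => x i ^ 2),
      ← Fin.sum_univ_eq_sum_range (fun i => w i ^ 2) n]
    set c := √(∑ i : Fin n, x i ^ 2) / √(∑ i : Fin n, w i ^ 2) with hc
    rw [← Real.sq_sqrt (show 0 ≤ ∑ i : Fin n, x i ^ 2 by positivity),
      ← Real.sq_sqrt (show 0 ≤ ∑ i : Fin n, w i ^ 2 by positivity), ← div_pow, ← hc]
    simp only [Pi.smul_apply, smul_eq_mul, mul_pow]
    rw [Fin.sum_univ_eq_sum_range (fun l => if l < k then c ^ 2 * w l ^ 2 else 0) n,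
      ← Finset.sum_filter, Finset.mul_sum]
    refine Finset.sum_congr ?_ fun i _ => rfl
    ext i
    simp
    omega
  rw [initialNorm, hsum, mul_sub, mul_one, ← Real.sqrt_mul (by norm_num),
    ← Real.sqrt_mul k.cast_nonneg]
  congr 2
  unfold meanSq
  rcases eq_or_ne (∑ i ∈ Finset.range n, w i ^ 2) 0 with h | h
  · simp [h]
  · field_simp

lemma sqrt_div_sub_one {p q r : ℝ} (hp : 0 ≤ p) (hq : 0 ≤ q) (hr : 0 < r) :
    √(p * q / r) - 1 = ((p - 1) + (q - 1) - (r - 1) + (q - 1) * (p - 1)) / 2 *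
      (2 / (r * (√(p * q / r) + 1))) := by
  have h := Real.sq_sqrt (show 0 ≤ p * q / r by positivity)
  have h0 := Real.sqrt_nonneg (p * q / r)
  set z := √(p * q / r)
  have hz : z + 1 ≠ 0 := by positivity
  have h' : r * z ^ 2 = p * q := by
    rw [h]
    field_simp
  field_simp
  linear_combination h'

lemma integral_three_mul_sq_sub_one_unifInterval :
    ∫ x, √5 / 2 * (3 * x ^ 2 - 1) ∂unifInterval = 0 := by
  rw [integral_unifInterval, intervalIntegral.integral_const_mul, intervalIntegral.integral_sub
    (Continuous.intervalIntegrable (by fun_prop) _ _)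
    (Continuous.intervalIntegrable (by fun_prop) _ _), intervalIntegral.integral_const_mul,
    integral_pow]
  norm_num

lemma integral_three_mul_sq_sub_one_sq_unifInterval :
    ∫ x, (√5 / 2 * (3 * x ^ 2 - 1)) ^ 2 ∂unifInterval = 1 := by
  have h (x : ℝ) : (√5 / 2 * (3 * x ^ 2 - 1)) ^ 2 =
      45 / 4 * x ^ 4 + (-(15 / 2) * x ^ 2 + 5 / 4) := by
    rw [mul_pow, div_pow, Real.sq_sqrt (by norm_num)]
    ring
  simp_rw [h]
  rw [integral_unifInterval, intervalIntegral.integral_add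
    (Continuous.intervalIntegrable (by fun_prop) _ _)
    (Continuous.intervalIntegrable (by fun_prop) _ _), intervalIntegral.integral_add
    (Continuous.intervalIntegrable (by fun_prop) _ _)
    (Continuous.intervalIntegrable (by fun_prop) _ _), intervalIntegral.integral_const_mul,
    intervalIntegral.integral_const_mul, integral_pow, integral_pow]
  norm_num

lemma integral_sq_unifInterval : ∫ x, x ^ 2 ∂unifInterval = 1 / 3 := by
  rw [integral_unifInterval, integral_pow]
  norm_num

lemma integrable_sq_unifInterval : Integrable (fun x => x ^ 2) unifInterval :=
  .of_integral_ne_zero (by rw [integral_sq_unifInterval]; norm_num)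

lemma integral_sq_sub_one_gaussianReal :
    ∫ x, (x ^ 2 - 1) / √2 ∂(gaussianReal 0 1) = 0 := by
  rw [integral_div, integral_sub (integrable_pow_gaussianReal 2) (integrable_const _),
    integral_sq_gaussianReal]
  simp

lemma integral_sq_sub_one_sq_gaussianReal :
    ∫ x, ((x ^ 2 - 1) / √2) ^ 2 ∂(gaussianReal 0 1) = 1 := by
  have h (x : ℝ) : ((x ^ 2 - 1) / √2) ^ 2 = (x ^ 4 - 2 * x ^ 2 + 1) / 2 := by
    rw [div_pow, Real.sq_sqrt (by norm_num)]
    ring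
  simp_rw [h]
  rw [integral_div, integral_add (f := fun x => x ^ 4 - 2 * x ^ 2)
      ((integrable_pow_gaussianReal 4).sub ((integrable_pow_gaussianReal 2).const_mul 2))
      (integrable_const _),
    integral_sub (integrable_pow_gaussianReal 4) ((integrable_pow_gaussianReal 2).const_mul 2),
    integral_const_mul, integral_sq_gaussianReal, integral_pow_four_gaussianReal]
  norm_num

/-- The joint law of an i.i.d. uniform sequence and an independent i.i.d. Gaussian sequence. -/
def unifGaussianLaw : Measure ((ℕ → ℝ) × (ℕ → ℝ)) :=
  (Measure.infinitePi fun _ => unifInterval).prod (Measure.infinitePi fun _ => gaussianReal 0 1)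

instance : IsProbabilityMeasure unifGaussianLaw := by
  unfold unifGaussianLaw
  infer_instance

lemma ae_tendsto_meanSq_unifGaussianLaw :
    ∀ᵐ ω ∂unifGaussianLaw, Tendsto (fun n => 3 * meanSq n ω.1) atTop (𝓝 1) ∧
      Tendsto (fun n => meanSq n ω.2) atTop (𝓝 1) := by
  have h1 := ae_tendsto_average_infinitePi (g := fun x => x ^ 2) (by fun_prop)
    integrable_sq_unifInterval
  have h2 := ae_tendsto_average_infinitePi (g := fun x => x ^ 2) (by fun_prop)
    (integrable_pow_gaussianReal 2)
  rw [integral_sq_unifInterval] at h1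
  rw [integral_sq_gaussianReal] at h2
  filter_upwards [Measure.quasiMeasurePreserving_fst.ae h1,
    Measure.quasiMeasurePreserving_snd.ae h2] with ω hω1 hω2
  exact ⟨by simpa [meanSq] using hω1.const_mul 3, hω2⟩

lemma tendsto_sqrt_div {k : ℕ → ℕ} {lam : ℝ} (hkinf : Tendsto (fun n => (k n : ℝ)) atTop atTop)
    (hklam : Tendsto (fun n => (k n : ℝ) / n) atTop (𝓝 lam)) :
    Tendsto (fun n => √(k n) / n) atTop (𝓝 0) := by
  have h := hklam.mul (Real.tendsto_sqrt_atTop.comp hkinf).inv_tendsto_atTop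
  rw [mul_zero] at h
  refine h.congr' ?_
  filter_upwards [hkinf.eventually_gt_atTop 0] with n hn
  have : √(k n : ℝ) ≠ 0 := (Real.sqrt_pos.2 hn).ne'
  simp only [Pi.inv_apply, Function.comp_apply]
  field_simp
  rw [Real.sq_sqrt hn.le]

/-- The part of the fluctuations that is linear in the means of squares is asymptotically
normal. -/
lemma tendstoInDistribution_linear_part {k : ℕ → ℕ} {lam : ℝ} (hk : ∀ᶠ n in atTop, k n ≤ n)
    (hkinf : Tendsto (fun n => (k n : ℝ)) atTop atTop)
    (hklam : Tendsto (fun n => (k n : ℝ) / n) atTop (𝓝 lam)) :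
    TendstoInDistribution (fun n (ω : (ℕ → ℝ) × (ℕ → ℝ)) => √(k n) / 2 *
        ((3 * meanSq n ω.1 - 1) + (meanSq (k n) ω.2 - 1) - (meanSq n ω.2 - 1))) atTop id
      (fun _ => unifGaussianLaw) (gaussianReal 0 (1 / 2 - 3 * lam / 10).toNNReal) := by
  have hr := tendsto_sqrt_div hkinf hklam
  have hs := (Real.tendsto_sqrt_atTop.comp hkinf).inv_tendsto_atTop
  have hpos := hkinf.eventually_gt_atTop 0
  have h := tendstoInDistribution_weighted_sum (ρ := unifInterval) (τ := gaussianReal 0 1)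
    (X := fun x => √5 / 2 * (3 * x ^ 2 - 1)) (Y := fun x => (x ^ 2 - 1) / √2)
    (α := fun n => √(k n) / n / √5) (β := fun n => ((√(k n))⁻¹ - √(k n) / n) / √2)
    (γ := fun n => -(√(k n) / n) / √2) (a := lam / 5) (b := (1 - lam) ^ 2 / 2)
    (c := (1 - lam) * lam / 2) (v := 1 / 2 - 3 * lam / 10)
    (by fun_prop) integral_three_mul_sq_sub_one_unifInterval
    integral_three_mul_sq_sub_one_sq_unifInterval (by fun_prop) integral_sq_sub_one_gaussianReal
    integral_sq_sub_one_sq_gaussianReal hk (by simpa using hr.div_const √5)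
    (by simpa using (hs.sub hr).div_const √2) (by simpa using hr.neg.div_const √2) ?_ ?_ ?_
    (by ring)
  · refine tendstoInDistribution_of_ae_eventually_eq h (fun n => by fun_prop)
      (ae_of_all _ fun ω => ?_)
    filter_upwards [hk, hpos] with n hkn hn
    have hk0 : k n ≠ 0 := by exact_mod_cast hn.ne'
    have hn0 : (n : ℝ) ≠ 0 := Nat.cast_ne_zero.2 (by omega)
    have hsk : √(k n : ℝ) ≠ 0 := (Real.sqrt_pos.2 hn).ne'
    have hsq := Real.sq_sqrt hn.le
    have h2 := Real.sq_sqrt (show (0 : ℝ) ≤ 2 by norm_num)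
    rw [sum_range_ite_mul hkn, ← Finset.mul_sum, ← Finset.mul_sum, ← Finset.sum_div,
      ← Finset.sum_div, sum_range_sq_sub_one hk0, sum_range_sq_sub_one (by omega),
      sum_range_three_mul_sq_sub_one (by omega), ← hsq, Real.sqrt_sq (Real.sqrt_nonneg _)]
    field_simp
    rw [h2]
    ring
  · refine (hklam.div_const 5).congr' ?_
    filter_upwards [hk, hpos] with n hkn hn
    have hn0 : (n : ℝ) ≠ 0 := fun h0 => by
      rw [Nat.cast_eq_zero] at h0
      simp [h0] at hkn
      simp [h0, hkn] at hn
    rw [div_pow, div_pow, Real.sq_sqrt hn.le, Real.sq_sqrt (by norm_num)]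
    field_simp
  · refine (((tendsto_const_nhds.sub hklam).pow 2).div_const 2).congr' ?_
    filter_upwards [hpos] with n hn
    have hsk : √(k n : ℝ) ≠ 0 := (Real.sqrt_pos.2 hn).ne'
    rw [div_pow, Real.sq_sqrt (by norm_num), mul_div_assoc']
    congr 1
    have hsq := Real.sq_sqrt hn.le
    set s := √(k n : ℝ)
    rw [← hsq, ← mul_pow, mul_sub, mul_inv_cancel₀ hsk]
    ring
  · refine (((tendsto_const_nhds.sub hklam).mul hklam).div_const 2).congr' ?_
    filter_upwards [hk, hpos] with n hkn hn
    have hn0 : (n : ℝ) ≠ 0 := fun h0 => by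
      rw [Nat.cast_eq_zero] at h0
      simp [h0] at hkn
      simp [h0, hkn] at hn
    rw [Nat.cast_sub hkn, div_pow, neg_sq, div_pow, Real.sq_sqrt hn.le, Real.sq_sqrt (by norm_num)]
    field_simp

lemma tendstoInDistribution_meanSq_gaussian {k : ℕ → ℕ} (hk : ∀ᶠ n in atTop, k n ≤ n)
    (hkinf : Tendsto (fun n => (k n : ℝ)) atTop atTop) :
    TendstoInDistribution (fun n (ω : (ℕ → ℝ) × (ℕ → ℝ)) => √(k n) * (meanSq (k n) ω.2 - 1))
      atTop id (fun _ => unifGaussianLaw) (gaussianReal 0 (Real.toNNReal 2)) := by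
  have hs := (Real.tendsto_sqrt_atTop.comp hkinf).inv_tendsto_atTop
  have hpos := hkinf.eventually_gt_atTop 0
  have h := tendstoInDistribution_weighted_sum (ρ := unifInterval) (τ := gaussianReal 0 1)
    (X := fun x => √5 / 2 * (3 * x ^ 2 - 1)) (Y := fun x => (x ^ 2 - 1) / √2)
    (α := fun _ => 0) (β := fun n => √2 * (√(k n))⁻¹)
    (γ := fun _ => 0) (a := 0) (b := 2) (c := 0) (v := 2)
    (by fun_prop) integral_three_mul_sq_sub_one_unifInterval
    integral_three_mul_sq_sub_one_sq_unifInterval (by fun_prop) integral_sq_sub_one_gaussianReal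
    integral_sq_sub_one_sq_gaussianReal hk tendsto_const_nhds
    (by simpa using hs.const_mul √2) tendsto_const_nhds (by simp) ?_ (by simp) (by ring)
  · refine tendstoInDistribution_of_ae_eventually_eq h (fun n => by fun_prop)
      (ae_of_all _ fun ω => ?_)
    filter_upwards [hk, hpos] with n hkn hn
    have hk0 : k n ≠ 0 := by exact_mod_cast hn.ne'
    have hsk : √(k n : ℝ) ≠ 0 := (Real.sqrt_pos.2 hn).ne'
    have hsq := Real.sq_sqrt hn.le
    rw [sum_range_ite_mul hkn, ← Finset.sum_div, ← Finset.sum_div, sum_range_sq_sub_one hk0]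
    simp only [zero_mul, Finset.sum_const_zero, zero_add, add_zero, sub_zero]
    field_simp
    rw [hsq, mul_comm]
  · refine tendsto_const_nhds.congr' ?_
    filter_upwards [hpos] with n hn
    rw [mul_pow, inv_pow, Real.sq_sqrt hn.le, Real.sq_sqrt (by norm_num)]
    field_simp

lemma tendstoInDistribution_initialNorm {k : ℕ → ℕ} {lam : ℝ} (hk : ∀ᶠ n in atTop, k n ≤ n)
    (hkinf : Tendsto (fun n => (k n : ℝ)) atTop atTop)
    (hklam : Tendsto (fun n => (k n : ℝ) / n) atTop (𝓝 lam)) :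
    TendstoInDistribution (fun n (ω : (ℕ → ℝ) × (ℕ → ℝ)) => √3 * initialNorm (k n)
        ((√(∑ i : Fin n, ω.1 i ^ 2) / √(∑ i : Fin n, ω.2 i ^ 2)) • fun i : Fin n => ω.2 i) -
          √(k n)) atTop id
      (fun _ => unifGaussianLaw) (gaussianReal 0 (1 / 2 - 3 * lam / 10).toNNReal) := by
  have hpos := hkinf.eventually_gt_atTop 0
  have hkinf' : Tendsto k atTop atTop := tendsto_natCast_atTop_iff.1 hkinf
  have hmeas (n : ℕ) : Measurable fun ω : (ℕ → ℝ) × (ℕ → ℝ) => √3 * initialNorm (k n)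
      ((√(∑ i : Fin n, ω.1 i ^ 2) / √(∑ i : Fin n, ω.2 i ^ 2)) • fun i : Fin n => ω.2 i) -
        √(k n) :=
    (((measurable_initialNorm (k n)).comp (by fun_prop)).const_mul _).sub_const _
  have hcross := tendstoInMeasure_mul_of_tendstoInDistribution
    (tendstoInDistribution_meanSq_gaussian hk hkinf)
    (V := fun n ω => (3 * meanSq n ω.1 - 1) / 2)
    (tendstoInMeasure_of_tendsto_ae (fun n => Measurable.aestronglyMeasurable (by fun_prop)) <| by
      filter_upwards [ae_tendsto_meanSq_unifGaussianLaw] with ω hω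
      simpa using (hω.1.sub_const 1).div_const 2)
    fun n => Measurable.aemeasurable (by fun_prop)
  have hsum := (tendstoInDistribution_linear_part hk hkinf hklam).add_of_tendstoInMeasure_const
    hcross fun n => Measurable.aemeasurable (by fun_prop)
  have hfactor : ∀ᵐ ω ∂unifGaussianLaw, Tendsto (fun n => 2 / (meanSq n ω.2 *
      (√(3 * meanSq n ω.1 * meanSq (k n) ω.2 / meanSq n ω.2) + 1))) atTop (𝓝 1) := by
    filter_upwards [ae_tendsto_meanSq_unifGaussianLaw] with ω hω
    have h := (tendsto_const_nhds (x := (2 : ℝ))).div (hω.2.mul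
      ((((hω.1.mul (hω.2.comp hkinf')).div hω.2 one_ne_zero).sqrt).add_const 1)) (by norm_num)
    convert h using 2
    simp
    norm_num
  have hprod := hsum.continuous_comp_prodMk_of_tendstoInMeasure_const
    (g := fun x : ℝ × ℝ => x.1 * x.2) (by fun_prop)
    (tendstoInMeasure_of_tendsto_ae (fun n => Measurable.aestronglyMeasurable (by fun_prop))
      hfactor) fun n => Measurable.aemeasurable (by fun_prop)
  simp only [id, add_zero, mul_one] at hprod
  refine tendstoInDistribution_of_ae_eventually_eq hprod hmeas ?_
  filter_upwards [ae_tendsto_meanSq_unifGaussianLaw] with ω hω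
  filter_upwards [hk, hpos, hω.2.eventually_const_lt one_pos] with n hkn hn hr
  have hk0 : k n ≠ 0 := by exact_mod_cast hn.ne'
  simp only [Pi.add_apply]
  rw [sqrt_three_mul_initialNorm_sub hk0 hkn]
  conv_lhs => rw [sqrt_div_sub_one (mul_nonneg zero_le_three (meanSq_nonneg _ _))
    (meanSq_nonneg _ _) hr]
  ring

theorem clt_projection_cube
    {Ω : Type*} [MeasurableSpace Ω] (P : Measure Ω) [IsProbabilityMeasure P]
    (X : (n : ℕ) → Ω → (Fin n → ℝ)) (O : (n : ℕ) → Ω → (Fin n → Fin n → ℝ))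
    (hXmeas : ∀ n, Measurable (X n)) (hOmeas : ∀ n, Measurable (O n))
    (hXlaw : ∀ n, Measure.map (X n) P = unifCube n)
    (hOorth : ∀ n ω, IsOrthMat (O n ω))
    (hOHaar : ∀ n (B : Fin n → Fin n → ℝ), IsOrthMat B →
      Measure.map (fun ω => matMul B (O n ω)) P = Measure.map (O n) P)
    (hXO : ∀ n, IndepFun (X n) (O n) P)
    (k : ℕ → ℕ) (hk : ∀ n, 1 ≤ n → 1 ≤ k n ∧ k n ≤ n)
    (hkinf : Tendsto (fun n => (k n : ℝ)) atTop atTop)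
    (lam : ℝ) (hlam : lam ∈ Set.Icc (0 : ℝ) 1)
    (hklam : Tendsto (fun n => (k n : ℝ) / n) atTop (𝓝 lam)) :
    ∀ f : BoundedContinuousFunction ℝ ℝ,
      Tendsto (fun (n : ℕ) => ∫ ω, f (Real.sqrt 3 *
          projEuclNorm (O n ω) (k n) (X n ω) - Real.sqrt (k n)) ∂P) atTop
        (𝓝 (∫ x, f x ∂(gaussianReal 0 (Real.toNNReal (1 / 2 - 3 * lam / 10))))) := by
  intro f
  have hkn : ∀ᶠ n in atTop, k n ≤ n := by
    filter_upwards [eventually_ge_atTop 1] with n hn using (hk n hn).2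
  have hdist := tendstoInDistribution_initialNorm hkn hkinf hklam
  have hlim := ProbabilityMeasure.tendsto_iff_forall_integral_tendsto.1 hdist.tendsto f
  simp only [ProbabilityMeasure.coe_mk, Measure.map_id] at hlim
  refine hlim.congr' ?_
  filter_upwards [eventually_ge_atTop 1] with n hn
  rw [integral_map (hdist.forall_aemeasurable n) f.continuous.aestronglyMeasurable]
  exact (integral_projEuclNorm_eq (by omega) (hXmeas n) (hOmeas n) (hXlaw n) (hOorth n)
    (hOHaar n) (hXO n) (k n) (g := fun y => f (√3 * y - √(k n)))
    (f.continuous.comp (by fun_prop)).measurable (C := ‖f‖) fun y => f.norm_coe_le_norm _).symm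
end
end

section
/- Let Y₁, Y₂, Y₃ be real random variables defined on a common probability space, let G be a centered Gaussian random variable with variance σ² > 0 (possibly on a different probability space), and let ε > 0. Then sup_{t∈ℝ} |P(Y₁+Y₂+Y₃ ≥ t) − P(G ≥ t)| ≤ sup_{x∈ℝ} |P(Y₁ ≥ x) − P(G ≥ x)| + P(|Y₂| > ε/2) + P(|Y₃| > ε/2) + ε/√(2πσ²). -/
open MeasureTheory ProbabilityTheory

/-- The density of a real Gaussian is bounded by its value at the mean. -/
theorem gaussianPDFReal_le_inv_sqrt (m : ℝ) (v : NNReal) (x : ℝ) :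
    gaussianPDFReal m v x ≤ (√(2 * Real.pi * v))⁻¹ := by
  rw [gaussianPDFReal]
  refine mul_le_of_le_one_right (by positivity) (Real.exp_le_one_iff.2 ?_)
  exact div_nonpos_of_nonpos_of_nonneg (neg_nonpos.2 (sq_nonneg _)) (by positivity)

/-- A nondegenerate real Gaussian gives an interval mass at most its length times the maximum
of the density. -/
theorem gaussianReal_real_Ico_le (m : ℝ) {v : NNReal} (hv : v ≠ 0) {a b : ℝ} (hab : a ≤ b) :
    (gaussianReal m v).real (Set.Ico a b) ≤ (b - a) / √(2 * Real.pi * v) := by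
  refine ENNReal.toReal_le_of_le_ofReal
    (div_nonneg (sub_nonneg.2 hab) (Real.sqrt_nonneg _)) ?_
  rw [gaussianReal_apply m hv]
  calc ∫⁻ x in Set.Ico a b, gaussianPDF m v x
      ≤ ∫⁻ _ in Set.Ico a b, ENNReal.ofReal (√(2 * Real.pi * v))⁻¹ :=
        lintegral_mono fun x => ENNReal.ofReal_le_ofReal (gaussianPDFReal_le_inv_sqrt m v x)
    _ = ENNReal.ofReal ((b - a) / √(2 * Real.pi * v)) := by
        rw [setLIntegral_const, Real.volume_Ico, ← ENNReal.ofReal_mul (by positivity),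
          div_eq_inv_mul]

/-- The tail function of a nondegenerate real Gaussian is Lipschitz. -/
theorem gaussianReal_real_Ici_le_add (m : ℝ) {v : NNReal} (hv : v ≠ 0) {a b : ℝ} (hab : a ≤ b) :
    (gaussianReal m v).real (Set.Ici a)
      ≤ (gaussianReal m v).real (Set.Ici b) + (b - a) / √(2 * Real.pi * v) := by
  rw [← Set.Ico_union_Ici_eq_Ici hab, add_comm]
  exact (measureReal_union_le _ _).trans
    (add_le_add_left (gaussianReal_real_Ico_le m hv hab) _)

/-- A union bound for an event contained in the union of three others. -/
theorem measureReal_le_add_add {Ω : Type*} [MeasurableSpace Ω] (P : Measure Ω)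
    [IsFiniteMeasure P] {s t u w : Set Ω} (h : s ⊆ t ∪ u ∪ w) :
    P.real s ≤ P.real t + P.real u + P.real w :=
  (measureReal_mono h).trans <| (measureReal_union_le _ _).trans <|
    add_le_add_left (measureReal_union_le _ _) _

/-- Splitting lemma: comparison of `P(Y₁+Y₂+Y₃ ≥ t)` with the Gaussian tail. -/
theorem split_probabilities
    {Ω : Type*} [MeasurableSpace Ω] (P : Measure Ω) [IsProbabilityMeasure P]
    (Y₁ Y₂ Y₃ : Ω → ℝ)
    (hY₁ : Measurable Y₁) (hY₂ : Measurable Y₂) (hY₃ : Measurable Y₃)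
    (σ2 : ℝ) (hσ2 : 0 < σ2) (ε : ℝ) (hε : 0 < ε) :
    ∀ t : ℝ,
      |(P {ω | t ≤ Y₁ ω + Y₂ ω + Y₃ ω}).toReal
          - ((gaussianReal 0 (Real.toNNReal σ2)) (Set.Ici t)).toReal|
        ≤ (⨆ x : ℝ, |(P {ω | x ≤ Y₁ ω}).toReal
              - ((gaussianReal 0 (Real.toNNReal σ2)) (Set.Ici x)).toReal|)
          + (P {ω | ε / 2 < |Y₂ ω|}).toReal + (P {ω | ε / 2 < |Y₃ ω|}).toReal
          + ε / Real.sqrt (2 * Real.pi * σ2) := by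
  intro t
  have hv : Real.toNNReal σ2 ≠ 0 := (Real.toNNReal_pos.2 hσ2).ne'
  simp only [← measureReal_def]
  set G := gaussianReal 0 (Real.toNNReal σ2)
  have hbdd : BddAbove (Set.range fun x : ℝ => |P.real {ω | x ≤ Y₁ ω} - G.real (Set.Ici x)|) := by
    refine ⟨1, ?_⟩
    rintro _ ⟨x, rfl⟩
    exact abs_sub_le_of_nonneg_of_le measureReal_nonneg measureReal_le_one
      measureReal_nonneg measureReal_le_one
  have hlower := abs_le.1 (le_ciSup hbdd (t + ε))
  have hupper := abs_le.1 (le_ciSup hbdd (t - ε))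
  have hunion_upper : P.real {ω | t ≤ Y₁ ω + Y₂ ω + Y₃ ω}
      ≤ P.real {ω | t - ε ≤ Y₁ ω} + P.real {ω | ε / 2 < |Y₂ ω|}
        + P.real {ω | ε / 2 < |Y₃ ω|} := by
    refine measureReal_le_add_add P fun ω hω => ?_
    simp only [Set.mem_union, Set.mem_ofPred_eq] at hω ⊢
    by_contra! h
    linarith [le_abs_self (Y₂ ω), le_abs_self (Y₃ ω)]
  have hunion_lower : P.real {ω | t + ε ≤ Y₁ ω}
      ≤ P.real {ω | t ≤ Y₁ ω + Y₂ ω + Y₃ ω} + P.real {ω | ε / 2 < |Y₂ ω|}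
        + P.real {ω | ε / 2 < |Y₃ ω|} := by
    refine measureReal_le_add_add P fun ω hω => ?_
    simp only [Set.mem_union, Set.mem_ofPred_eq] at hω ⊢
    by_contra! h
    linarith [neg_abs_le (Y₂ ω), neg_abs_le (Y₃ ω)]
  have hG_upper := gaussianReal_real_Ici_le_add 0 hv (sub_le_self t hε.le)
  have hG_lower := gaussianReal_real_Ici_le_add 0 hv (le_add_of_nonneg_right hε.le : t ≤ t + ε)
  rw [Real.coe_toNNReal _ hσ2.le, sub_sub_cancel] at hG_upper
  rw [Real.coe_toNNReal _ hσ2.le, add_sub_cancel_left] at hG_lower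
  refine abs_le.2 ⟨?_, ?_⟩ <;> linarith
end
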